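/- Let D' ≤ D, N ≥ 1, r ≥ 1 and B ≥ 1. Let K, Q ∈ ℝ^{D'×D} have all entries of absolute value at most B. Let X, X' ∈ ℝ^{D×N} have all entries in [−r, r], and let x, x' ∈ ℝ^D have all entries in [−r, r]. Then ‖Softmax((K X)^⊤(Q x)) − Softmax((K X')^⊤(Q x'))‖₁ ≤ 4 r B² D³ · max{‖X − X'‖_∞, ‖x − x'‖_∞}, where (K X)^⊤(Q x) ∈ ℝ^N and ‖·‖_∞ of a matrix denotes its maximum absolute entry. -/

import Mathlib

open Matrix

/-- Softmax of a vector in ℝ^n: `softmax x i = exp (x i) / ∑ j, exp (x j)`. -/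
noncomputable def softmax {n : ℕ} (x : Fin n → ℝ) : Fin n → ℝ :=
  fun i => Real.exp (x i) / ∑ j, Real.exp (x j)

lemma softmax_pos {n : ℕ} (u : Fin n → ℝ) (i : Fin n) : 0 < softmax u i :=
  div_pos (Real.exp_pos _) (Finset.sum_pos (fun j _ => Real.exp_pos (u j)) ⟨i, Finset.mem_univ i⟩)

lemma sum_softmax {n : ℕ} [NeZero n] (u : Fin n → ℝ) : ∑ i, softmax u i = 1 := by
  have h : 0 < ∑ j, Real.exp (u j) :=
    Finset.sum_pos (fun j _ => Real.exp_pos (u j)) Finset.univ_nonempty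
  simp only [softmax, ← Finset.sum_div]
  exact div_self h.ne'

lemma log_softmax {n : ℕ} (u : Fin n → ℝ) (i : Fin n) :
    Real.log (softmax u i) = u i - Real.log (∑ j, Real.exp (u j)) := by
  have h : 0 < ∑ j, Real.exp (u j) :=
    Finset.sum_pos (fun j _ => Real.exp_pos (u j)) ⟨i, Finset.mem_univ i⟩
  rw [softmax, Real.log_div (Real.exp_pos _).ne' h.ne', Real.log_exp]

lemma sq_sub_div_add_le_sub_mul_log_sub_log {a b : ℝ} (ha : 0 < a) (hb : 0 < b) :
    (a - b) ^ 2 / (a + b) ≤ (a - b) * (Real.log a - Real.log b) := by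
  wlog hab : b ≤ a generalizing a b
  · have h := this hb ha (le_of_not_ge hab)
    rw [add_comm b a, ← neg_sub a b, neg_sq] at h
    linarith
  have hlog : 1 - b / a ≤ Real.log a - Real.log b := by
    have h := Real.log_le_sub_one_of_pos (div_pos hb ha)
    rw [Real.log_div hb.ne' ha.ne'] at h
    linarith
  have hdiv : (a - b) / (a + b) ≤ 1 - b / a := by
    rw [one_sub_div ha.ne']
    exact div_le_div_of_nonneg_left (sub_nonneg.2 hab) ha (by linarith)
  rw [sq, mul_div_assoc]
  exact mul_le_mul_of_nonneg_left (hdiv.trans hlog) (sub_nonneg.2 hab)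

/-- Softmax is `2`-Lipschitz from the sup norm to the `ℓ¹` norm. The symmetrised relative entropy
`∑ (p - q) (log p - log q)` of two softmax vectors is at most `ε ‖p - q‖₁`, and at least
`‖p - q‖₁² / 2` by Cauchy-Schwarz. -/
lemma sum_abs_softmax_sub_le {n : ℕ} [NeZero n] {u v : Fin n → ℝ} {ε : ℝ}
    (h : ∀ i, |u i - v i| ≤ ε) : ∑ i, |softmax u i - softmax v i| ≤ 2 * ε := by
  set p := softmax u with hp
  set q := softmax v with hq
  have hpos : ∀ i, 0 < p i + q i := fun i => add_pos (softmax_pos u i) (softmax_pos v i)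
  have hε : 0 ≤ ε := (abs_nonneg _).trans (h 0)
  have hcs : (∑ i, |p i - q i|) ^ 2 ≤ (∑ i, (p i - q i) ^ 2 / (p i + q i)) * 2 := by
    have hsum : ∑ i, (p i + q i) = 2 := by
      rw [Finset.sum_add_distrib, sum_softmax, sum_softmax]; norm_num
    rw [← hsum]
    refine Finset.sum_sq_le_sum_mul_sum_of_sq_le_mul _
      (fun i _ => div_nonneg (sq_nonneg _) (hpos i).le) (fun i _ => (hpos i).le) fun i _ => ?_
    rw [sq_abs, div_mul_cancel₀ _ (hpos i).ne']
  have hent : ∑ i, (p i - q i) ^ 2 / (p i + q i) ≤ ε * ∑ i, |p i - q i| := by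
    set c := Real.log (∑ j, Real.exp (u j)) - Real.log (∑ j, Real.exp (v j)) with hc
    calc ∑ i, (p i - q i) ^ 2 / (p i + q i)
        ≤ ∑ i, (p i - q i) * (Real.log (p i) - Real.log (q i)) :=
          Finset.sum_le_sum fun i _ =>
            sq_sub_div_add_le_sub_mul_log_sub_log (softmax_pos u i) (softmax_pos v i)
      _ = ∑ i, ((p i - q i) * (u i - v i) - (p i - q i) * c) := by
          refine Finset.sum_congr rfl fun i _ => ?_
          rw [hp, hq, log_softmax, log_softmax, hc]; ring
      _ = ∑ i, (p i - q i) * (u i - v i) := by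
          rw [Finset.sum_sub_distrib, ← Finset.sum_mul, Finset.sum_sub_distrib, sum_softmax,
            sum_softmax, sub_self, zero_mul, sub_zero]
      _ ≤ ∑ i, ε * |p i - q i| := by
          refine Finset.sum_le_sum fun i _ => (le_abs_self _).trans ?_
          rw [abs_mul, mul_comm]
          exact mul_le_mul_of_nonneg_right (h i) (abs_nonneg _)
      _ = ε * ∑ i, |p i - q i| := (Finset.mul_sum _ _ _).symm
  by_contra! hlt
  nlinarith

lemma abs_mulVec_le {m n : ℕ} {A : Matrix (Fin m) (Fin n) ℝ} {w : Fin n → ℝ} {B s : ℝ}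
    (hB : 0 ≤ B) (hA : ∀ a i, |A a i| ≤ B) (hw : ∀ i, |w i| ≤ s) (a : Fin m) :
    |(A *ᵥ w) a| ≤ n * (B * s) := by
  calc |∑ i, A a i * w i| ≤ ∑ i, |A a i * w i| := Finset.abs_sum_le_sum_abs _ _
    _ ≤ ∑ _i : Fin n, B * s := Finset.sum_le_sum fun i _ => by
        rw [abs_mul]; exact mul_le_mul (hA a i) (hw i) (abs_nonneg _) hB
    _ = n * (B * s) := by simp

lemma abs_mulVec_dotProduct_mulVec_sub_le {m n : ℕ} {K Q : Matrix (Fin m) (Fin n) ℝ}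
    {y y' x x' : Fin n → ℝ} {B r δ : ℝ} (hB : 0 ≤ B)
    (hK : ∀ a i, |K a i| ≤ B) (hQ : ∀ a i, |Q a i| ≤ B)
    (hx : ∀ i, |x i| ≤ r) (hy' : ∀ i, |y' i| ≤ r)
    (hy : ∀ i, |y i - y' i| ≤ δ) (hxx' : ∀ i, |x i - x' i| ≤ δ) :
    |∑ a, (K *ᵥ y) a * (Q *ᵥ x) a - ∑ a, (K *ᵥ y') a * (Q *ᵥ x') a| ≤
      m * (2 * r * B ^ 2 * n ^ 2 * δ) := by
  rw [← Finset.sum_sub_distrib]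
  calc |∑ a, ((K *ᵥ y) a * (Q *ᵥ x) a - (K *ᵥ y') a * (Q *ᵥ x') a)|
      ≤ ∑ a, |(K *ᵥ y) a * (Q *ᵥ x) a - (K *ᵥ y') a * (Q *ᵥ x') a| :=
        Finset.abs_sum_le_sum_abs _ _
    _ ≤ ∑ _a : Fin m, 2 * r * B ^ 2 * n ^ 2 * δ := Finset.sum_le_sum fun a _ => ?_
    _ = m * (2 * r * B ^ 2 * n ^ 2 * δ) := by simp
  have hsplit : (K *ᵥ y) a * (Q *ᵥ x) a - (K *ᵥ y') a * (Q *ᵥ x') a =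
      (K *ᵥ (y - y')) a * (Q *ᵥ x) a + (K *ᵥ y') a * (Q *ᵥ (x - x')) a := by
    simp only [mulVec_sub, Pi.sub_apply]; ring
  have h₁ := abs_mulVec_le (w := y - y') hB hK hy a
  have h₂ := abs_mulVec_le hB hQ hx a
  have h₃ := abs_mulVec_le hB hK hy' a
  have h₄ := abs_mulVec_le (w := x - x') hB hQ hxx' a
  rw [hsplit]
  refine (abs_add_le _ _).trans ?_
  rw [abs_mul, abs_mul]
  refine (add_le_add (mul_le_mul h₁ h₂ (abs_nonneg _) ((abs_nonneg _).trans h₁))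
    (mul_le_mul h₃ h₄ (abs_nonneg _) ((abs_nonneg _).trans h₃))).trans_eq ?_
  ring

/-- Lipschitz continuity of the attention weights: for key/query matrices `K, Q` with
entries bounded by `B` and data `X, X', x, x'` with entries in `[−r, r]`,
`‖Softmax((KX)ᵀ(Qx)) − Softmax((KX')ᵀ(Qx'))‖₁ ≤ 4 r B² D³ · max{‖X−X'‖_∞, ‖x−x'‖_∞}`. -/
theorem attention_score_lipschitz (D Dp N : ℕ) (hDp : Dp ≤ D) (hN : 1 ≤ N)
    (r B : ℝ) (hr : 1 ≤ r) (hB : 1 ≤ B)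
    (K Q : Matrix (Fin Dp) (Fin D) ℝ)
    (hK : ∀ a i, |K a i| ≤ B) (hQ : ∀ a i, |Q a i| ≤ B)
    (X X' : Matrix (Fin D) (Fin N) ℝ) (x x' : Fin D → ℝ)
    (hX : ∀ k n, |X k n| ≤ r) (hX' : ∀ k n, |X' k n| ≤ r)
    (hx : ∀ k, |x k| ≤ r) (hx' : ∀ k, |x' k| ≤ r) :
    ∑ n, |softmax (fun m : Fin N => ∑ a, (K *ᵥ fun k => X k m) a * (Q *ᵥ x) a) n -
          softmax (fun m : Fin N => ∑ a, (K *ᵥ fun k => X' k m) a * (Q *ᵥ x') a) n| ≤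
      4 * r * B ^ 2 * (D : ℝ) ^ 3 *
        max (⨆ k, ⨆ m, |X k m - X' k m|) (⨆ k, |x k - x' k|) := by
  have : NeZero N := ⟨by omega⟩
  set δ := max (⨆ k, ⨆ m, |X k m - X' k m|) (⨆ k, |x k - x' k|)
  have hδ : 0 ≤ δ := le_max_of_le_right (Real.iSup_nonneg fun _ => abs_nonneg _)
  have hXδ : ∀ k m, |X k m - X' k m| ≤ δ := fun k m =>
    ((le_ciSup (f := fun m => |X k m - X' k m|) (Set.finite_range _).bddAbove m).trans
      (le_ciSup (f := fun k => ⨆ m, |X k m - X' k m|) (Set.finite_range _).bddAbove k)).trans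
      (le_max_left _ _)
  have hxδ : ∀ k, |x k - x' k| ≤ δ := fun k =>
    (le_ciSup (f := fun k => |x k - x' k|) (Set.finite_range _).bddAbove k).trans
      (le_max_right _ _)
  have hDp' : (Dp : ℝ) ≤ D := Nat.cast_le.2 hDp
  refine (sum_abs_softmax_sub_le fun m => abs_mulVec_dotProduct_mulVec_sub_le
    (zero_le_one.trans hB) hK hQ hx (fun k => hX' k m) (fun k => hXδ k m) hxδ).trans ?_
  calc 2 * (Dp * (2 * r * B ^ 2 * D ^ 2 * δ))
      ≤ 2 * (D * (2 * r * B ^ 2 * D ^ 2 * δ)) := by gcongr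
    _ = 4 * r * B ^ 2 * D ^ 3 * δ := by ring
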